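/- arXiv:2212.01621 — 2 statements merged into one kernel-verified Lean document; each statement's English description precedes it below -/
import Mathlib

section
/- Let X be an ℝ^p-valued random vector and Y = (Y_1,…,Y_q) an ℝ^q-valued random vector with non-degenerate components, all defined on a common probability space. Then T(Y|X) = 1 if and only if Y is perfectly dependent on X, i.e., there exists a measurable function f : ℝ^p → ℝ^q such that Y = f(X) almost surely. -/
open MeasureTheory ProbabilityTheory

/-- Azadkia–Chatterjee's rank correlation `ξ(Y | m)` of a real random variable `Y`
given a sub-σ-algebra `m`. -/
noncomputable def xiSigma {Ω : Type*} (m : MeasurableSpace Ω) [MeasurableSpace Ω]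
    (P : Measure Ω) (Y : Ω → ℝ) : ℝ :=
  (∫ y, variance (P[Set.indicator {ω | y ≤ Y ω} (fun _ => (1 : ℝ)) | m]) P ∂(P.map Y)) /
  (∫ y, variance (Set.indicator {ω | y ≤ Y ω} (fun _ => (1 : ℝ))) P ∂(P.map Y))

/-- Azadkia–Chatterjee's rank correlation `ξ(Y | X)`: conditioning on the σ-algebra
generated by the random vector `X`. -/
noncomputable def xi {Ω α : Type*} [MeasurableSpace Ω] [MeasurableSpace α]
    (P : Measure Ω) (Y : Ω → ℝ) (X : Ω → α) : ℝ :=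
  xiSigma (MeasurableSpace.comap X inferInstance) P Y

/-- The σ-algebra generated by the response variables with index `< i`,
i.e. by `(Y_1, …, Y_{i-1})`; for `i = 0` it is the trivial σ-algebra `⊥`,
so that `xiSigma (sigmaPast Y 0) P (Y 0) = ξ(Y_1 | ∅) = 0`. -/
def sigmaPast {Ω : Type*} {q : ℕ} (Y : Fin q → Ω → ℝ) (i : Fin q) :
    MeasurableSpace Ω :=
  ⨆ j : Fin q, ⨆ _ : j < i, MeasurableSpace.comap (Y j) inferInstance

/-- The extension `T(Y | X)` of Azadkia–Chatterjee's rank correlation to a vector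
`Y = (Y_1, …, Y_q)` of response variables, given the predictor vector `X`:
`T(Y|X) = 1 − (q − ∑_i ξ(Y_i | (X,Y_{i−1},…,Y_1))) / (q − ∑_i ξ(Y_i | (Y_{i−1},…,Y_1)))`. -/
noncomputable def T {Ω α : Type*} [MeasurableSpace Ω] [MeasurableSpace α]
    (P : Measure Ω) {q : ℕ} (Y : Fin q → Ω → ℝ) (X : Ω → α) : ℝ :=
  1 - ((q : ℝ) - ∑ i, xiSigma (MeasurableSpace.comap X inferInstance ⊔ sigmaPast Y i) P (Y i)) /
      ((q : ℝ) - ∑ i, xiSigma (sigmaPast Y i) P (Y i))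

/-- A real random variable is non-degenerate if it is not almost surely constant. -/
def Nondegenerate {Ω : Type*} [MeasurableSpace Ω] (P : Measure Ω) (Y : Ω → ℝ) : Prop :=
  ¬ ∃ c : ℝ, ∀ᵐ ω ∂P, Y ω = c

section EventuallyMeasurable

open Set Filter

variable {Ω : Type*} {m m₀ : MeasurableSpace Ω} {P : Measure Ω}

theorem EventuallyMeasurableSet.of_le_eventuallyMeasurableSpace {m' : MeasurableSpace Ω}
    {l : Filter Ω} [CountableInterFilter l] {s : Set Ω}
    (hs : EventuallyMeasurableSet m l s) (hm : m ≤ eventuallyMeasurableSpace m' l) :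
    EventuallyMeasurableSet m' l s := by
  obtain ⟨t, ht, hst⟩ := hs
  exact EventuallyMeasurableSet.congr (hm t ht) hst

/-- A set of reals that is bounded below contains a countable subset generating the same union
of closed upper rays. -/
theorem exists_countable_subset_forall_exists_le (S : Set ℝ) (hS : BddBelow S) :
    ∃ C ⊆ S, C.Countable ∧ ∀ x ∈ S, ∃ c ∈ C, c ≤ x := by
  rcases S.eq_empty_or_nonempty with rfl | hne
  · exact ⟨∅, Subset.rfl, countable_empty, by simp⟩
  by_cases hmem : sInf S ∈ S
  · exact ⟨{sInf S}, by simpa using hmem, countable_singleton _,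
      fun x hx => ⟨_, rfl, csInf_le hS hx⟩⟩
  · obtain ⟨u, -, hu, huS⟩ := exists_seq_tendsto_sInf hne hS
    refine ⟨range u, range_subset_iff.2 huS, countable_range u, fun x hx => ?_⟩
    have hlt : sInf S < x := (csInf_le hS hx).lt_of_ne fun h => hmem (h ▸ hx)
    obtain ⟨n, hn⟩ := (hu.eventually (gt_mem_nhds hlt)).exists
    exact ⟨u n, mem_range_self n, hn.le⟩

/-- If almost every upper level set of `Y`, with respect to the law of `Y`, agrees almost surely
with a set of `m`, then so does every preimage of a Borel set. -/
theorem eventuallyMeasurable_of_ae_map_Ici {Y : Ω → ℝ}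
    (hY : Measurable Y)
    (h : ∀ᵐ y ∂(P.map Y), EventuallyMeasurableSet m (ae P) {ω | y ≤ Y ω}) :
    EventuallyMeasurable m (ae P) Y := by
  refine @measurable_of_Ici ℝ Ω _ _ _ (eventuallyMeasurableSpace m (ae P)) _ _ _ _ fun r => ?_
  let S := {y | EventuallyMeasurableSet m (ae P) {ω | y ≤ Y ω}} ∩ Ici r
  obtain ⟨C, hCS, hC, hdom⟩ :=
    exists_countable_subset_forall_exists_le S ⟨r, fun x hx => hx.2⟩
  have hmeas : EventuallyMeasurableSet m (ae P) (⋃ c ∈ C, {ω | c ≤ Y ω}) :=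
    @MeasurableSet.biUnion _ _ (eventuallyMeasurableSpace m (ae P)) _ _ hC
      fun c hc => (hCS hc).1
  refine hmeas.congr (eventuallyEq_set.2 ?_)
  filter_upwards [ae_of_ae_map hY.aemeasurable h] with ω hω
  simp only [mem_preimage, mem_Ici, mem_iUnion, mem_ofPred_eq, exists_prop]
  exact ⟨fun hr => hdom _ ⟨hω, hr⟩, fun ⟨c, hc, hcY⟩ => (hCS hc).2.trans hcY⟩

/-- A real function that is measurable modulo null sets with respect to the σ-algebra generated
by `X` is almost surely a measurable function of `X`. -/
theorem exists_measurable_ae_eq_comp_of_eventuallyMeasurable_comap {α : Type*}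
    [mα : MeasurableSpace α] {X : Ω → α} {Y : Ω → ℝ}
    (h : EventuallyMeasurable (mα.comap X) (ae P) Y) :
    ∃ f : α → ℝ, Measurable f ∧ ∀ᵐ ω ∂P, Y ω = f (X ω) := by
  have hlevel (r : ℚ) : ∃ C : Set α, MeasurableSet C ∧ Y ⁻¹' Ici (r : ℝ) =ᵐ[P] X ⁻¹' C := by
    obtain ⟨t, ⟨C, hC, rfl⟩, hst⟩ := h (measurableSet_Ici (a := (r : ℝ)))
    exact ⟨C, hC, hst⟩
  choose C hC hYC using hlevel
  let Ψ : ℝ → ℚ → Prop := fun t r => (r : ℝ) ≤ t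
  have hΨ : Measurable Ψ :=
    measurable_pi_iff.2 fun r => measurableSet_setOfPred.1 measurableSet_Ici
  have hΨ_inj : Function.Injective Ψ := by
    intro a b hab
    refine le_antisymm ?_ ?_ <;> refine le_of_forall_rat_lt_imp_le fun r hr => ?_
    · exact (iff_of_eq (congrFun hab r)).1 hr.le
    · exact (iff_of_eq (congrFun hab r)).2 hr.le
  have hemb := hΨ.measurableEmbedding hΨ_inj
  let Φ : α → ℚ → Prop := fun x r => x ∈ C r
  have hΦ : Measurable Φ := measurable_pi_iff.2 fun r => measurableSet_setOfPred.1 (hC r)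
  refine ⟨hemb.invFun ∘ Φ, hemb.measurable_invFun.comp hΦ, ?_⟩
  filter_upwards [ae_all_iff.2 fun r => (eventuallyEq_set.1 (hYC r))] with ω hω
  have : Φ (X ω) = Ψ (Y ω) := funext fun r => propext (hω r).symm
  simp only [Function.comp_apply, this]
  exact (hemb.leftInverse_invFun (Y ω)).symm

end EventuallyMeasurable

section VarianceCondExp

open Set Filter

variable {Ω : Type*} {m m₀ : MeasurableSpace Ω} {P : Measure Ω} [IsProbabilityMeasure P]

theorem variance_eq_variance_condExp_add {Z : Ω → ℝ} (hm : m ≤ m₀) (hZ : MemLp Z 2 P) :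
    variance Z P = variance (P[Z | m]) P + ∫ ω, ((Z - P[Z | m]) ^ 2) ω ∂P := by
  rw [← integral_condVar_add_variance_condExp hm hZ, condVar, integral_condExp hm, add_comm]

theorem memLp_two_indicator_one {s : Set Ω} (hs : MeasurableSet s) :
    MemLp (s.indicator fun _ => (1 : ℝ)) 2 P :=
  memLp_indicator_const 2 hs 1 (Or.inr (measure_ne_top P s))

theorem variance_condExp_le {Z : Ω → ℝ} (hm : m ≤ m₀) (hZ : MemLp Z 2 P) :
    variance (P[Z | m]) P ≤ variance Z P := by
  rw [variance_eq_variance_condExp_add hm hZ]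
  exact le_add_of_nonneg_right (integral_nonneg fun ω => sq_nonneg _)

theorem variance_condExp_indicator_eq_iff {s : Set Ω} (hm : m ≤ m₀) (hs : MeasurableSet s) :
    variance (P[s.indicator fun _ => (1 : ℝ) | m]) P = variance (s.indicator fun _ => (1 : ℝ)) P ↔
      EventuallyMeasurableSet m (ae P) s := by
  have hZ := memLp_two_indicator_one (P := P) hs
  constructor
  · intro h
    have h0 : ∫ ω, (((s.indicator fun _ => (1 : ℝ)) -
        P[s.indicator fun _ => (1 : ℝ) | m]) ^ 2) ω ∂P = 0 := by
      linarith [variance_eq_variance_condExp_add hm hZ]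
    replace h0 := (integral_eq_zero_iff_of_nonneg (fun ω => sq_nonneg _)
      (hZ.sub (hZ.condExp one_le_two)).integrable_sq).1 h0
    refine ⟨(P[s.indicator fun _ => (1 : ℝ) | m]) ⁻¹' {1},
      stronglyMeasurable_condExp.measurable (measurableSet_singleton 1), ?_⟩
    refine eventuallyEq_set.2 ?_
    filter_upwards [h0] with ω hω
    have hω' : s.indicator (fun _ => (1 : ℝ)) ω = (P[s.indicator fun _ => (1 : ℝ) | m]) ω :=
      sub_eq_zero.1 (pow_eq_zero_iff two_ne_zero |>.1 hω)
    rw [mem_preimage, ← hω', mem_singleton_iff]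
    by_cases hωs : ω ∈ s <;> simp [hωs]
  · rintro ⟨t, ht, hst⟩
    have hae : (s.indicator fun _ => (1 : ℝ)) =ᵐ[P] t.indicator fun _ => (1 : ℝ) :=
      indicator_ae_eq_of_ae_eq_set hst
    refine variance_congr (condExp_of_aestronglyMeasurable' hm ?_ (hZ.integrable one_le_two))
    exact ⟨_, stronglyMeasurable_const.indicator ht, hae⟩

/-- The conditional survival probabilities are monotone in the threshold, so their variance is
a measurable function of the threshold. -/
theorem measurable_variance_condExp_indicator_Ici {Y : Ω → ℝ} (hY : Measurable Y) :
    Measurable fun y => variance (P[{ω | y ≤ Y ω}.indicator fun _ => (1 : ℝ) | m]) P := by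
  have hs (y : ℝ) : MeasurableSet {ω | y ≤ Y ω} := measurableSet_le measurable_const hY
  have hZ (y : ℝ) := memLp_two_indicator_one (P := P) (hs y)
  have hC (y : ℝ) := (hZ y).condExp (m := m) one_le_two
  have hmono {a b : ℝ} (hab : a ≤ b) :
      P[{ω | b ≤ Y ω}.indicator fun _ => (1 : ℝ) | m] ≤ᵐ[P]
        P[{ω | a ≤ Y ω}.indicator fun _ => (1 : ℝ) | m] :=
    condExp_mono ((hZ b).integrable one_le_two) ((hZ a).integrable one_le_two)
      (ae_of_all _ (indicator_le_indicator_of_subset (fun _ h => hab.trans h)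
        fun _ => zero_le_one))
  have hnonneg (y : ℝ) : 0 ≤ᵐ[P] P[{ω | y ≤ Y ω}.indicator fun _ => (1 : ℝ) | m] :=
    condExp_nonneg (ae_of_all _ (indicator_nonneg fun _ _ => zero_le_one))
  simp_rw [fun y => variance_eq_sub (hC y)]
  refine Measurable.sub (Antitone.measurable fun a b hab => ?_)
    (Measurable.pow_const (Antitone.measurable fun a b hab => ?_) 2)
  · refine integral_mono_ae (hC b).integrable_sq (hC a).integrable_sq ?_
    filter_upwards [hmono hab, hnonneg b] with ω h h0
    exact pow_le_pow_left₀ h0 h 2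
  · exact integral_mono_ae ((hC b).integrable one_le_two) ((hC a).integrable one_le_two)
      (hmono hab)

theorem variance_indicator_one_le_one {s : Set Ω} (hs : MeasurableSet s) :
    variance (s.indicator fun _ => (1 : ℝ)) P ≤ 1 := by
  refine (variance_le_expectation_sq (memLp_two_indicator_one hs).aestronglyMeasurable).trans ?_
  calc _ ≤ ∫ _, (1 : ℝ) ∂P := by
        refine integral_mono (memLp_two_indicator_one hs).integrable_sq (integrable_const _) ?_
        intro ω
        by_cases h : ω ∈ s <;> simp [h]
    _ = 1 := by simp

theorem integrable_variance_condExp_indicator_Ici {Y : Ω → ℝ} (hm : m ≤ m₀) (hY : Measurable Y) :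
    Integrable (fun y => variance (P[{ω | y ≤ Y ω}.indicator fun _ => (1 : ℝ) | m]) P)
      (P.map Y) := by
  have := Measure.isProbabilityMeasure_map (μ := P) hY.aemeasurable
  refine Integrable.of_bound
    (measurable_variance_condExp_indicator_Ici hY).aestronglyMeasurable 1 (ae_of_all _ fun y => ?_)
  have hs : MeasurableSet {ω | y ≤ Y ω} := measurableSet_le measurable_const hY
  rw [Real.norm_of_nonneg (variance_nonneg _ _)]
  exact (variance_condExp_le hm (memLp_two_indicator_one hs)).trans
    (variance_indicator_one_le_one hs)

theorem integrable_variance_indicator_Ici {Y : Ω → ℝ} (hY : Measurable Y) :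
    Integrable (fun y => variance ({ω | y ≤ Y ω}.indicator fun _ => (1 : ℝ)) P) (P.map Y) := by
  refine (integrable_variance_condExp_indicator_Ici (m := m₀) le_rfl hY).congr
    (ae_of_all _ fun y => ?_)
  have hs : MeasurableSet {ω | y ≤ Y ω} := measurableSet_le measurable_const hY
  exact (variance_condExp_indicator_eq_iff le_rfl hs).2 hs.eventuallyMeasurableSet

theorem integral_variance_condExp_le {Y : Ω → ℝ} (hm : m ≤ m₀) (hY : Measurable Y) :
    ∫ y, variance (P[{ω | y ≤ Y ω}.indicator fun _ => (1 : ℝ) | m]) P ∂(P.map Y) ≤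
      ∫ y, variance ({ω | y ≤ Y ω}.indicator fun _ => (1 : ℝ)) P ∂(P.map Y) :=
  integral_mono (integrable_variance_condExp_indicator_Ici hm hY)
    (integrable_variance_indicator_Ici hY)
    fun _ => variance_condExp_le hm
      (memLp_two_indicator_one (measurableSet_le measurable_const hY))

theorem integral_variance_condExp_eq_iff {Y : Ω → ℝ} (hm : m ≤ m₀) (hY : Measurable Y) :
    ∫ y, variance (P[{ω | y ≤ Y ω}.indicator fun _ => (1 : ℝ) | m]) P ∂(P.map Y) =
      ∫ y, variance ({ω | y ≤ Y ω}.indicator fun _ => (1 : ℝ)) P ∂(P.map Y) ↔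
      EventuallyMeasurable m (ae P) Y := by
  have hs (y : ℝ) : MeasurableSet {ω | y ≤ Y ω} := measurableSet_le measurable_const hY
  rw [integral_eq_iff_of_ae_le (integrable_variance_condExp_indicator_Ici hm hY)
    (integrable_variance_indicator_Ici hY)
    (ae_of_all _ fun y => variance_condExp_le hm (memLp_two_indicator_one (hs y)))]
  constructor
  · intro h
    refine eventuallyMeasurable_of_ae_map_Ici hY ?_
    filter_upwards [h] with y hy
    exact (variance_condExp_indicator_eq_iff hm (hs y)).1 hy
  · intro h
    exact ae_of_all _ fun y => (variance_condExp_indicator_eq_iff hm (hs y)).2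
      (h measurableSet_Ici)

end VarianceCondExp

section RankCorrelation

open Set Filter

variable {Ω : Type*} {m : MeasurableSpace Ω} [m₀ : MeasurableSpace Ω] {P : Measure Ω}
  [IsProbabilityMeasure P]

theorem integral_variance_condExp_bot (Y : Ω → ℝ) :
    ∫ y, variance (P[{ω | y ≤ Y ω}.indicator fun _ => (1 : ℝ) | ⊥]) P ∂(P.map Y) = 0 := by
  simp only [condExp_bot]
  refine integral_eq_zero_of_ae (ae_of_all _ fun y => ?_)
  simpa using variance_const_add (μ := P) aestronglyMeasurable_zero _

theorem Nondegenerate.integral_variance_indicator_pos {Y : Ω → ℝ} (hnd : Nondegenerate P Y)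
    (hY : Measurable Y) :
    0 < ∫ y, variance ({ω | y ≤ Y ω}.indicator fun _ => (1 : ℝ)) P ∂(P.map Y) := by
  refine (integral_nonneg fun y => variance_nonneg _ _).lt_of_ne fun h => hnd ?_
  have hbot : EventuallyMeasurable ⊥ (ae P) Y :=
    (integral_variance_condExp_eq_iff bot_le hY).1 ((integral_variance_condExp_bot Y).trans h)
  rw [← MeasurableSpace.comap_const (m := inferInstanceAs (MeasurableSpace Unit)) ()] at hbot
  obtain ⟨f, -, hf⟩ := exists_measurable_ae_eq_comp_of_eventuallyMeasurable_comap hbot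
  exact ⟨f (), hf⟩

theorem xiSigma_bot (Y : Ω → ℝ) : xiSigma ⊥ P Y = 0 := by
  rw [xiSigma, integral_variance_condExp_bot, zero_div]

theorem xiSigma_le_one {Y : Ω → ℝ} (hm : m ≤ m₀) (hY : Measurable Y) : xiSigma m P Y ≤ 1 :=
  div_le_one_of_le₀ (integral_variance_condExp_le hm hY)
    (integral_nonneg fun _ => variance_nonneg _ _)

theorem xiSigma_eq_one_iff {Y : Ω → ℝ} (hm : m ≤ m₀) (hY : Measurable Y)
    (hnd : Nondegenerate P Y) : xiSigma m P Y = 1 ↔ EventuallyMeasurable m (ae P) Y := by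
  rw [xiSigma, div_eq_one_iff_eq (hnd.integral_variance_indicator_pos hY).ne',
    integral_variance_condExp_eq_iff hm hY]

theorem sigmaPast_le {q : ℕ} {Y : Fin q → Ω → ℝ} (hY : ∀ i, Measurable (Y i)) (i : Fin q) :
    sigmaPast Y i ≤ m₀ :=
  iSup₂_le fun j _ => (hY j).comap_le

theorem sum_xiSigma_sigmaPast_lt {q : ℕ} (hq : 0 < q) {Y : Fin q → Ω → ℝ}
    (hY : ∀ i, Measurable (Y i)) : ∑ i, xiSigma (sigmaPast Y i) P (Y i) < q := by
  have hbot : sigmaPast Y ⟨0, hq⟩ = ⊥ := by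
    simp [sigmaPast, Fin.lt_def]
  calc ∑ i, xiSigma (sigmaPast Y i) P (Y i) < ∑ _i : Fin q, (1 : ℝ) :=
        Finset.sum_lt_sum (fun i _ => xiSigma_le_one (sigmaPast_le hY i) (hY i))
          ⟨⟨0, hq⟩, Finset.mem_univ _, by rw [hbot, xiSigma_bot]; exact one_pos⟩
    _ = q := by simp

theorem T_eq_one_iff_forall_xiSigma_eq_one {α : Type*} [MeasurableSpace α] {q : ℕ}
    {X : Ω → α} {Y : Fin q → Ω → ℝ} (hX : Measurable X) (hY : ∀ i, Measurable (Y i)) :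
    T P Y X = 1 ↔
      ∀ i, xiSigma (MeasurableSpace.comap X inferInstance ⊔ sigmaPast Y i) P (Y i) = 1 := by
  rcases Nat.eq_zero_or_pos q with rfl | hq
  · simp [T]
  have hden := sub_ne_zero.2 (sum_xiSigma_sigmaPast_lt (P := P) hq hY).ne'
  have hle (i : Fin q) (_ : i ∈ Finset.univ) :=
    xiSigma_le_one (P := P) (sup_le hX.comap_le (sigmaPast_le hY i)) (hY i)
  rw [T, sub_eq_self, div_eq_zero_iff, or_iff_left hden, sub_eq_zero, eq_comm]
  have hsum := Finset.sum_eq_sum_iff_of_le hle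
  simpa using hsum

end RankCorrelation

theorem T_eq_one_iff_perfect_dependence
    {Ω : Type*} [MeasurableSpace Ω] (P : Measure Ω) [IsProbabilityMeasure P]
    {p q : ℕ} (X : Ω → (Fin p → ℝ)) (Y : Fin q → Ω → ℝ)
    (hX : Measurable X) (hY : ∀ i, Measurable (Y i))
    (hnd : ∀ i, Nondegenerate P (Y i)) :
    T P Y X = 1 ↔
      ∃ f : (Fin p → ℝ) → (Fin q → ℝ), Measurable f ∧
        ∀ᵐ ω ∂P, (fun i => Y i ω) = f (X ω) := by
  rw [T_eq_one_iff_forall_xiSigma_eq_one hX hY]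
  simp_rw [fun i => xiSigma_eq_one_iff (sup_le hX.comap_le (sigmaPast_le hY i)) (hY i) (hnd i)]
  constructor
  · intro h
    have hYX (i : Fin q) :
        EventuallyMeasurable (MeasurableSpace.comap X inferInstance) (ae P) (Y i) := by
      induction i using WellFoundedLT.induction with
      | ind i ih =>
        intro s hs
        refine EventuallyMeasurableSet.of_le_eventuallyMeasurableSpace (h i hs)
          (sup_le le_eventuallyMeasurableSpace (iSup₂_le fun j hj => ?_))
        exact measurable_iff_comap_le.1 (ih j hj)
    choose f hf hfX using fun i =>
      exists_measurable_ae_eq_comp_of_eventuallyMeasurable_comap (hYX i)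
    refine ⟨fun x i => f i x, measurable_pi_iff.2 hf, ?_⟩
    filter_upwards [ae_all_iff.2 hfX] with ω hω
    exact funext hω
  · rintro ⟨f, hf, hfX⟩ i
    have hfi : Measurable[MeasurableSpace.comap X inferInstance ⊔ sigmaPast Y i]
        (fun ω => f (X ω) i) :=
      (((measurable_pi_apply i).comp hf).comp (comap_measurable X)).mono le_sup_left le_rfl
    refine hfi.eventuallyMeasurable_of_eventuallyEq ?_
    filter_upwards [hfX] with ω hω
    exact congrFun hω i
end

section
/- Closed-form expression for the multivariate normal distribution: suppose (X,Y) is an (p+1)-dimensional centered Gaussian random vector with covariance matrix Σ having block decomposition Σ = [[Σ_{11}, Σ_{12}], [Σ_{21}, 1]], where Σ_{11} is the p×p covariance matrix of X, Σ_{12} = Σ_{21}^T is p×1, and Var(Y) = 1. Then for any generalized inverse Σ_{11}^− of Σ_{11} (i.e., any p×p matrix G with Σ_{11} G Σ_{11} = Σ_{11}), Chatterjee's rank correlation equals ξ(Y|X) = (3/π) · arcsin((1+ρ²)/2) − 1/2, where ρ = √(Σ_{21} Σ_{11}^− Σ_{12}). -/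
open MeasureTheory ProbabilityTheory

open Matrix in
/-- `W` is a centered Gaussian random vector with covariance matrix `S`:
every linear combination `⟨a, W⟩` is a centered real Gaussian with variance `aᵀ S a`. -/
def IsCenteredGaussianVec {Ω : Type*} [MeasurableSpace Ω] (P : Measure Ω) {n : ℕ}
    (W : Ω → (Fin n → ℝ)) (S : Matrix (Fin n) (Fin n) ℝ) : Prop :=
  ∀ a : Fin n → ℝ,
    P.map (fun ω => ∑ i, a i * W ω i) =
      gaussianReal 0 (Real.toNNReal (a ⬝ᵥ S.mulVec a))

open Matrix in
/-- `W` is a Gaussian random vector with mean vector `m` and covariance matrix `S`: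
every linear combination `⟨a, W⟩` is a real Gaussian with mean `⟨a, m⟩` and
variance `aᵀ S a`. -/
def IsGaussianVec {Ω : Type*} [MeasurableSpace Ω] (P : Measure Ω) {n : ℕ}
    (W : Ω → (Fin n → ℝ)) (m : Fin n → ℝ) (S : Matrix (Fin n) (Fin n) ℝ) : Prop :=
  ∀ a : Fin n → ℝ,
    P.map (fun ω => ∑ i, a i * W ω i) =
      gaussianReal (∑ i, a i * m i) (Real.toNNReal (a ⬝ᵥ S.mulVec a))

/-- The standard Gaussian measure of a planar cone is proportional to its angle. -/
lemma gaussianReal_prod_cone_eq_mul {W : Set (ℝ × ℝ)} (hW : MeasurableSet W) {Θ : Set ℝ}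
    (hΘ : MeasurableSet Θ)
    (h : ∀ r : ℝ, 0 < r → ∀ θ ∈ Set.Ioo (-Real.pi) Real.pi,
      ((r * Real.cos θ, r * Real.sin θ) ∈ W ↔ θ ∈ Θ)) :
    ((gaussianReal 0 1).prod (gaussianReal 0 1)) W =
      (∫⁻ r in Set.Ioi (0 : ℝ), ENNReal.ofReal (r * ((2 * Real.pi)⁻¹ * Real.exp (-r ^ 2 / 2)))) *
        volume (Θ ∩ Set.Ioo (-Real.pi) Real.pi) := by
  rw [gaussianReal_of_var_ne_zero _ one_ne_zero,
    prod_withDensity (measurable_gaussianPDF _ _) (measurable_gaussianPDF _ _),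
    withDensity_apply _ hW, ← lintegral_indicator hW, ← Measure.volume_eq_prod,
    ← lintegral_comp_polarCoord_symm, polarCoord_target]
  have hvol : volume (Θ ∩ Set.Ioo (-Real.pi) Real.pi) =
      ∫⁻ θ in Set.Ioo (-Real.pi) Real.pi, Θ.indicator 1 θ := by
    rw [lintegral_indicator_one hΘ, Measure.restrict_apply hΘ]
  rw [hvol, Measure.volume_eq_prod, ← Measure.prod_restrict, ← lintegral_prod_mul
    (by fun_prop) (by measurability), Measure.prod_restrict]
  refine setLIntegral_congr_fun (measurableSet_Ioi.prod measurableSet_Ioo) ?_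
  rintro ⟨r, θ⟩ ⟨hr, hθ⟩
  simp only [Set.mem_Ioi] at hr
  by_cases hmem : θ ∈ Θ
  · simp only [polarCoord_symm_apply, Set.indicator_of_mem ((h r hr θ hθ).2 hmem),
      Set.indicator_of_mem hmem, Pi.one_apply, mul_one, smul_eq_mul, gaussianPDF]
    rw [← ENNReal.ofReal_mul (gaussianPDFReal_nonneg _ _ _), ← ENNReal.ofReal_mul hr.le]
    congr 2
    simp only [gaussianPDFReal, NNReal.coe_one, mul_one, sub_zero]
    rw [mul_mul_mul_comm, ← Real.exp_add, ← mul_inv, Real.mul_self_sqrt (by positivity)]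
    congr 2
    linear_combination -r ^ 2 / 2 * Real.sin_sq_add_cos_sq θ
  · simp [polarCoord_symm_apply, (h r hr θ hθ).not.2 hmem, hmem]

lemma gaussianReal_prod_wedge {α : ℝ} (h0 : 0 ≤ α) (h1 : α < Real.pi / 2) :
    ((gaussianReal 0 1).prod (gaussianReal 0 1)).real
      {q | Real.sin α * |q.2| ≤ Real.cos α * q.1} = 1 / 2 - α / Real.pi := by
  have hpi := Real.pi_pos
  have htot := gaussianReal_prod_cone_eq_mul MeasurableSet.univ MeasurableSet.univ
    (fun r _ θ _ ↦ by simp)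
  rw [measure_univ, Set.univ_inter, Real.volume_Ioo] at htot
  have hW : MeasurableSet {q : ℝ × ℝ | Real.sin α * |q.2| ≤ Real.cos α * q.1} :=
    measurableSet_le (by fun_prop) (by fun_prop)
  have hwedge := gaussianReal_prod_cone_eq_mul hW
    (measurableSet_Icc (a := -(Real.pi / 2 - α)) (b := Real.pi / 2 - α)) (by
      intro r hr θ hθ
      rw [Set.mem_Icc, ← abs_le, Set.mem_ofPred_eq]
      have habs : |θ| < Real.pi := abs_lt.2 hθ
      have hsin : |r * Real.sin θ| = r * Real.sin |θ| := by
        rw [abs_mul, abs_of_pos hr, Real.abs_sin_eq_sin_abs_of_abs_le_pi habs.le]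
      rw [hsin, ← Real.cos_abs θ]
      have key : Real.sin α * (r * Real.sin |θ|) ≤ Real.cos α * (r * Real.cos |θ|) ↔
          0 ≤ Real.cos (|θ| + α) := by
        rw [Real.cos_add, ← mul_nonneg_iff_of_pos_left hr, ← sub_nonneg]
        ring_nf
      rw [key]
      constructor
      · intro hc
        by_contra! hlt
        exact (Real.cos_neg_of_pi_div_two_lt_of_lt (x := |θ| + α) (by linarith)
          (by linarith)).not_ge hc
      · intro hle
        exact Real.cos_nonneg_of_neg_pi_div_two_le_of_le
          (by linarith [abs_nonneg θ]) (by linarith))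
  have hsub : Set.Icc (-(Real.pi / 2 - α)) (Real.pi / 2 - α) ⊆ Set.Ioo (-Real.pi) Real.pi :=
    fun x hx ↦ ⟨by linarith [hx.1], by linarith [hx.2]⟩
  rw [Set.inter_eq_left.2 hsub, Real.volume_Icc] at hwedge
  rw [Measure.real, hwedge, ENNReal.toReal_mul, ENNReal.toReal_ofReal (by linarith)]
  have htot' := congrArg ENNReal.toReal htot
  rw [ENNReal.toReal_mul, ENNReal.toReal_ofReal (by linarith), ENNReal.toReal_one] at htot'
  set C := ENNReal.toReal _
  have hC : C = (2 * Real.pi)⁻¹ := by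
    rw [← mul_eq_one_iff_eq_inv₀ (by positivity), htot']
    ring
  rw [hC]
  field_simp
  ring

lemma charFunDual_gaussianReal (v : NNReal) (L : StrongDual ℝ ℝ) :
    charFunDual (gaussianReal 0 v) L = Complex.exp (-((v * L 1 ^ 2 : ℝ) : ℂ) / 2) := by
  rw [charFunDual_eq_charFun_map_one, gaussianReal_map_continuousLinearMap, charFun_gaussianReal]
  congr 1
  simp [max_eq_left (sq_nonneg (L 1))]
  ring

/-- The law of `(Z + U - Y, Z + U' - Y)` for independent centered Gaussians `Y`, `Z`, `U`, `U'`,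
written as the image of a standard planar Gaussian measure. -/
lemma map_gaussianReal_prod_eq {s v : NNReal} (hsv : s + v = 1) {α : ℝ}
    (hα : Real.cos (2 * α) = (1 + s) / 2) :
    ((gaussianReal 0 1).prod ((gaussianReal 0 s).prod
      ((gaussianReal 0 v).prod (gaussianReal 0 v)))).map
      (fun q ↦ (q.2.1 + q.2.2.1 - q.1, q.2.1 + q.2.2.2 - q.1)) =
    ((gaussianReal 0 1).prod (gaussianReal 0 1)).map
      (fun q ↦ (√2 * (Real.cos α * q.1 + Real.sin α * q.2),
        √2 * (Real.cos α * q.1 - Real.sin α * q.2))) := by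
  let Φ : ℝ × ℝ × ℝ × ℝ →L[ℝ] ℝ × ℝ :=
    LinearMap.toContinuousLinearMap
      { toFun := fun q ↦ (q.2.1 + q.2.2.1 - q.1, q.2.1 + q.2.2.2 - q.1)
        map_add' := fun a b ↦ by ext <;> simp <;> ring
        map_smul' := fun c a ↦ by ext <;> simp <;> ring }
  let D : ℝ × ℝ →L[ℝ] ℝ × ℝ :=
    LinearMap.toContinuousLinearMap
      { toFun := fun q ↦ (√2 * (Real.cos α * q.1 + Real.sin α * q.2),
          √2 * (Real.cos α * q.1 - Real.sin α * q.2))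
        map_add' := fun a b ↦ by ext <;> simp <;> ring
        map_smul' := fun c a ↦ by ext <;> simp <;> ring }
  change Measure.map Φ _ = Measure.map D _
  have : IsProbabilityMeasure (((gaussianReal 0 1).prod ((gaussianReal 0 s).prod
      ((gaussianReal 0 v).prod (gaussianReal 0 v)))).map Φ) :=
    Measure.isProbabilityMeasure_map (by fun_prop)
  have : IsProbabilityMeasure (((gaussianReal 0 1).prod (gaussianReal 0 1)).map D) :=
    Measure.isProbabilityMeasure_map (by fun_prop)
  refine Measure.ext_of_charFunDual ?_
  ext L
  have hL (a b : ℝ) : L (a, b) = a * L (1, 0) + b * L (0, 1) := by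
    rw [← smul_eq_mul, ← smul_eq_mul, ← map_smul, ← map_smul, ← map_add]
    simp
  simp only [charFunDual_map, charFunDual_prod, charFunDual_gaussianReal, ← Complex.exp_add]
  congr 1
  simp only [← add_div, ← neg_add, ← Complex.ofReal_add]
  congr 3
  have hT (q : ℝ × ℝ × ℝ × ℝ) : Φ q = (q.2.1 + q.2.2.1 - q.1, q.2.1 + q.2.2.2 - q.1) := rfl
  have hD (q : ℝ × ℝ) : D q = (√2 * (Real.cos α * q.1 + Real.sin α * q.2),
          √2 * (Real.cos α * q.1 - Real.sin α * q.2)) := rfl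
  simp only [ContinuousLinearMap.comp_apply, ContinuousLinearMap.inl_apply,
    ContinuousLinearMap.inr_apply, hT, hD]
  generalize hp : L (1, 0) = p at hL
  generalize hq : L (0, 1) = q at hL
  simp only [hL, Prod.fst_zero, Prod.snd_zero, NNReal.coe_one]
  have hv : (v : ℝ) = 1 - s := by
    rw [eq_sub_iff_add_eq', ← NNReal.coe_add, hsv, NNReal.coe_one]
  have h2 : √(2 : ℝ) ^ 2 = 2 := Real.sq_sqrt (by norm_num)
  have hc : Real.cos α ^ 2 = (3 + s) / 4 := by
    rw [Real.cos_sq, hα]; ring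
  have hs : Real.sin α ^ 2 = (1 - s) / 4 := by
    rw [Real.sin_sq, hc]; ring
  rw [hv]
  ring_nf
  rw [h2, hc, hs]
  ring

lemma gaussianReal_prod_orthant {s v : NNReal} (hsv : s + v = 1) :
    ((gaussianReal 0 1).prod ((gaussianReal 0 s).prod
      ((gaussianReal 0 v).prod (gaussianReal 0 v)))).real
      {q | q.1 ≤ q.2.1 + q.2.2.1 ∧ q.1 ≤ q.2.1 + q.2.2.2} =
      1 / 4 + Real.arcsin ((1 + s) / 2) / (2 * Real.pi) := by
  have hs : (s : ℝ) ≤ 1 := by exact_mod_cast le_of_add_le_left hsv.le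
  have hs0 : (0 : ℝ) ≤ s := s.2
  set α : ℝ := Real.arccos ((1 + s) / 2) / 2 with hα_def
  have hα : Real.cos (2 * α) = (1 + s) / 2 := by
    rw [hα_def, mul_div_cancel₀ _ two_ne_zero, Real.cos_arccos (by linarith) (by linarith)]
  have hα0 : 0 ≤ α := by have := Real.arccos_nonneg ((1 + s) / 2 : ℝ); positivity
  have hα1 : α < Real.pi / 2 := by
    have : Real.arccos ((1 + s) / 2 : ℝ) ≤ Real.pi / 2 :=
      Real.arccos_le_pi_div_two.2 (by positivity)
    linarith [Real.pi_pos]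
  have hmeas : MeasurableSet (Set.Ici (0 : ℝ) ×ˢ Set.Ici (0 : ℝ)) :=
    measurableSet_Ici.prod measurableSet_Ici
  have key := congrArg (fun ν ↦ ν.real (Set.Ici (0 : ℝ) ×ˢ Set.Ici (0 : ℝ)))
    (map_gaussianReal_prod_eq hsv hα)
  beta_reduce at key
  rw [map_measureReal_apply (by fun_prop) hmeas, map_measureReal_apply (by fun_prop) hmeas] at key
  have hsin : 0 ≤ Real.sin α :=
    Real.sin_nonneg_of_nonneg_of_le_pi hα0 (by linarith [Real.pi_pos])
  calc _ = _ := by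
        congr 1
        ext q
        simp
    _ = _ := key
    _ = ((gaussianReal 0 1).prod (gaussianReal 0 1)).real
        {q | Real.sin α * |q.2| ≤ Real.cos α * q.1} := by
        congr 1
        ext q
        rw [Set.mem_ofPred_eq, ← abs_of_nonneg hsin, ← abs_mul, abs_le, abs_of_nonneg hsin]
        simp only [Set.mem_preimage, Set.mem_prod, Set.mem_Ici,
          mul_nonneg_iff_of_pos_left (show 0 < √(2 : ℝ) by positivity)]
        constructor <;> rintro ⟨h1, h2⟩ <;> constructor <;> linarith
    _ = 1 / 2 - α / Real.pi := gaussianReal_prod_wedge hα0 hα1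
    _ = _ := by
        rw [hα_def, Real.arccos_eq_pi_div_two_sub_arcsin]
        field_simp
        ring

lemma measureReal_prod_eq_integral {α β : Type*} [MeasurableSpace α] [MeasurableSpace β]
    (μ : Measure α) (ν : Measure β) [IsFiniteMeasure μ] [IsFiniteMeasure ν] {S : Set (α × β)}
    (hS : MeasurableSet S) :
    (μ.prod ν).real S = ∫ x, ν.real (Prod.mk x ⁻¹' S) ∂μ := by
  simp_rw [Measure.real]
  rw [Measure.prod_apply hS, integral_toReal (measurable_measure_prodMk_left hS).aemeasurable
    (Filter.Eventually.of_forall fun _ ↦ measure_lt_top _ _)]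

/-- The survival function `t ↦ P(U ≥ t)` of a centered Gaussian `U` of variance `v`. -/
noncomputable def gaussianSurvival (v : NNReal) (t : ℝ) : ℝ :=
  (gaussianReal 0 v).real (Set.Ici t)

@[fun_prop]
lemma measurable_gaussianSurvival (v : NNReal) : Measurable (gaussianSurvival v) :=
  Antitone.measurable fun _ _ h ↦ measureReal_mono (Set.Ici_subset_Ici.2 h)

lemma gaussianSurvival_nonneg (v : NNReal) (t : ℝ) : 0 ≤ gaussianSurvival v t :=
  measureReal_nonneg

lemma gaussianSurvival_le_one (v : NNReal) (t : ℝ) : gaussianSurvival v t ≤ 1 :=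
  measureReal_le_one

lemma integral_gaussianSurvival_sub {s v : NNReal} (hsv : s + v = 1) (y : ℝ) :
    ∫ z, gaussianSurvival v (y - z) ∂gaussianReal 0 s = gaussianSurvival 1 y := by
  have hconv := gaussianReal_conv_gaussianReal (m₁ := 0) (m₂ := 0) (v₁ := s) (v₂ := v)
  rw [hsv, add_zero] at hconv
  rw [gaussianSurvival, ← hconv, Measure.conv, map_measureReal_apply (by fun_prop)
    measurableSet_Ici, measureReal_prod_eq_integral _ _ (measurable_add measurableSet_Ici)]
  congr! 2 with z
  rw [gaussianSurvival]
  congr 1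
  ext u
  simp [add_comm]

lemma integral_integral_sq_gaussianSurvival {s v : NNReal} (hsv : s + v = 1) :
    ∫ y, ∫ z, gaussianSurvival v (y - z) ^ 2 ∂gaussianReal 0 s ∂gaussianReal 0 1 =
      1 / 4 + Real.arcsin ((1 + s) / 2) / (2 * Real.pi) := by
  have hmeas {γ : Type} [MeasurableSpace γ] {f g h : γ → ℝ} (hf : Measurable f)
      (hg : Measurable g) (hh : Measurable h) : MeasurableSet {q | f q ≤ g q ∧ f q ≤ h q} :=
    (measurableSet_le hf hg).inter (measurableSet_le hf hh)
  rw [← gaussianReal_prod_orthant hsv, measureReal_prod_eq_integral]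
  swap
  · exact hmeas (by fun_prop) (by fun_prop) (by fun_prop)
  congr! 2 with y
  rw [measureReal_prod_eq_integral]
  swap
  · exact hmeas (by fun_prop) (by fun_prop) (by fun_prop)
  congr! 2 with z
  rw [gaussianSurvival, sq, ← measureReal_prod_prod]
  congr 1
  ext u
  simp [Prod.le_def, add_comm]

/-- The mean conditional variance gain when a standard Gaussian is decomposed as `Z + U`
with `Z` and `U` independent centered Gaussians of variances `s` and `v`. -/
lemma integral_variance_gaussianSurvival {Ω : Type*} [MeasurableSpace Ω] (P : Measure Ω)
    [IsProbabilityMeasure P] {s v : NNReal} (hsv : s + v = 1) {Z : Ω → ℝ} (hZ : Measurable Z)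
    (hlaw : P.map Z = gaussianReal 0 s) :
    ∫ y, variance (fun ω ↦ gaussianSurvival v (y - Z ω)) P ∂gaussianReal 0 1 =
      (Real.arcsin ((1 + s) / 2) - Real.pi / 6) / (2 * Real.pi) := by
  have hbound (w : NNReal) (t : ℝ) : ‖gaussianSurvival w t ^ 2‖ ≤ 1 := by
    rw [norm_pow, Real.norm_of_nonneg (gaussianSurvival_nonneg w t)]
    exact pow_le_one₀ (gaussianSurvival_nonneg w t) (gaussianSurvival_le_one w t)
  have hvar (y : ℝ) : variance (fun ω ↦ gaussianSurvival v (y - Z ω)) P =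
      ∫ z, gaussianSurvival v (y - z) ^ 2 ∂gaussianReal 0 s - gaussianSurvival 1 y ^ 2 := by
    rw [variance_eq_sub, ← integral_gaussianSurvival_sub hsv, ← hlaw,
      integral_map hZ.aemeasurable (Measurable.aestronglyMeasurable (by fun_prop)),
      integral_map hZ.aemeasurable (Measurable.aestronglyMeasurable (by fun_prop))]
    · rfl
    · refine MemLp.of_bound (Measurable.aestronglyMeasurable (by fun_prop)) 1
        (.of_forall fun ω ↦ ?_)
      rw [Real.norm_of_nonneg (gaussianSurvival_nonneg _ _)]
      exact gaussianSurvival_le_one _ _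
  have hzero := integral_integral_sq_gaussianSurvival (zero_add (1 : NNReal))
  simp only [gaussianReal_zero_var, integral_dirac, sub_zero, NNReal.coe_zero, add_zero] at hzero
  have harcsin : Real.arcsin (1 / 2) = Real.pi / 6 := by
    rw [← Real.sin_pi_div_six, Real.arcsin_sin] <;> linarith [Real.pi_pos]
  simp_rw [hvar]
  rw [integral_sub, integral_integral_sq_gaussianSurvival hsv, hzero, harcsin]
  · ring
  · refine .of_bound (StronglyMeasurable.integral_prod_right
      (Measurable.stronglyMeasurable ?_)).aestronglyMeasurable 1 (.of_forall fun y ↦ ?_)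
    · fun_prop
    · simpa using norm_integral_le_of_norm_le_const (μ := gaussianReal 0 s)
        (.of_forall fun z ↦ hbound v (y - z))
  · exact .of_bound (Measurable.aestronglyMeasurable (by fun_prop)) 1
      (.of_forall fun y ↦ hbound 1 y)

/-- If `Y = g(X) + U` with a centered Gaussian `U` independent of `X`, then
`P(Y ≥ y | X)` is the survival function of `U` evaluated at `y - g(X)`. -/
lemma condExp_indicator_le_ae_eq {Ω α : Type*} [MeasurableSpace Ω] [MeasurableSpace α]
    (P : Measure Ω) [IsProbabilityMeasure P] {X : Ω → α} (hX : Measurable X) {U : Ω → ℝ}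
    (hU : Measurable U) (hXU : IndepFun X U P) {v : NNReal} (hlaw : P.map U = gaussianReal 0 v)
    {g : α → ℝ} (hg : Measurable g) (y : ℝ) :
    P[Set.indicator {ω | y ≤ g (X ω) + U ω} (fun _ ↦ (1 : ℝ)) |
      MeasurableSpace.comap X inferInstance] =ᵐ[P]
      fun ω ↦ gaussianSurvival v (y - g (X ω)) := by
  have hS : MeasurableSet {q : α × ℝ | y ≤ g q.1 + q.2} :=
    measurableSet_le (by fun_prop) (by fun_prop)
  have hcond : condDistrib U X P =ᵐ[P.map X] Kernel.const α (gaussianReal 0 v) := by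
    refine condDistrib_ae_eq_of_measure_eq_compProd X hU.aemeasurable ?_
    rw [Measure.compProd_const, ← hlaw,
      (indepFun_iff_map_prod_eq_prod_map_map hX.aemeasurable hU.aemeasurable).1 hXU]
  have hf : Measurable ({q : α × ℝ | y ≤ g q.1 + q.2}.indicator fun _ ↦ (1 : ℝ)) :=
    measurable_const.indicator hS
  have hint : Integrable (fun ω ↦ {q : α × ℝ | y ≤ g q.1 + q.2}.indicator
      (fun _ ↦ (1 : ℝ)) (X ω, U ω)) P := by
    refine .of_bound (hf.comp (hX.prodMk hU)).aestronglyMeasurable 1 (.of_forall fun ω ↦ ?_)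
    exact (norm_indicator_le_norm_self _ _).trans (by simp)
  refine (condExp_prod_ae_eq_integral_condDistrib hX hU.aemeasurable hf.stronglyMeasurable
    hint).trans ?_
  filter_upwards [ae_of_ae_map hX.aemeasurable hcond] with ω hω
  rw [hω, Kernel.const_apply, gaussianSurvival, ← integral_indicator_one measurableSet_Ici]
  congr 1
  ext u
  simp [Set.indicator_apply, add_comm]

lemma ContinuousLinearMap.apply_eq_sum_single {ι : Type*} [Fintype ι] [DecidableEq ι]
    (L : (ι → ℝ) →L[ℝ] ℝ) (x : ι → ℝ) : L x = ∑ i, L (Pi.single i 1) * x i := by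
  conv_lhs => rw [← Finset.univ_sum_single x, map_sum]
  refine Finset.sum_congr rfl fun i _ ↦ ?_
  rw [mul_comm, ← smul_eq_mul, ← map_smul, ← Pi.single_smul, smul_eq_mul, mul_one]

lemma Measurable.finSnoc {Ω : Type*} [MeasurableSpace Ω] {p : ℕ} {X : Ω → Fin p → ℝ} {Y : Ω → ℝ}
    (hX : Measurable X) (hY : Measurable Y) :
    Measurable fun ω ↦ (Fin.snoc (X ω) (Y ω) : Fin (p + 1) → ℝ) := by
  rw [measurable_pi_iff] at hX ⊢
  exact Fin.lastCases (by simpa using hY) fun i ↦ by simpa using hX i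

namespace IsCenteredGaussianVec

open Matrix

variable {Ω : Type*} [MeasurableSpace Ω] {P : Measure Ω} {n : ℕ} {W : Ω → Fin n → ℝ}
  {S : Matrix (Fin n) (Fin n) ℝ}

lemma hasGaussianLaw (h : IsCenteredGaussianVec P W S) (hW : Measurable W) :
    HasGaussianLaw W P where
  isGaussian_map := by
    refine isGaussian_of_map_eq_gaussianReal fun L ↦ ?_
    refine ⟨_, _, Eq.trans ?_ (h fun i ↦ L (Pi.single i 1))⟩
    rw [Measure.map_map (by fun_prop) hW]
    congr 1
    ext ω
    exact L.apply_eq_sum_single (W ω)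

lemma memLp_two (h : IsCenteredGaussianVec P W S) (a : Fin n → ℝ) :
    MemLp (fun ω ↦ ∑ i, a i * W ω i) 2 P :=
  HasGaussianLaw.memLp_two (@IsGaussian.hasGaussianLaw _ _ _ _ _ _ _ _ _ (by
    rw [h a]; infer_instance))

lemma variance_eq (h : IsCenteredGaussianVec P W S) (hW : Measurable W) (hS : S.PosSemidef)
    (a : Fin n → ℝ) : variance (fun ω ↦ ∑ i, a i * W ω i) P = a ⬝ᵥ S *ᵥ a := by
  rw [← variance_id_map (by fun_prop), h a, variance_id_gaussianReal, Real.coe_toNNReal]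
  simpa using hS.dotProduct_mulVec_nonneg a

lemma covariance_eq [IsProbabilityMeasure P] (h : IsCenteredGaussianVec P W S)
    (hW : Measurable W) (hS : S.PosSemidef) (a b : Fin n → ℝ) :
    covariance (fun ω ↦ ∑ i, a i * W ω i) (fun ω ↦ ∑ i, b i * W ω i) P = a ⬝ᵥ S *ᵥ b := by
  have hadd := variance_fun_add (h.memLp_two a) (h.memLp_two b)
  have hab := h.variance_eq hW hS (a + b)
  simp only [Pi.add_apply, add_mul, Finset.sum_add_distrib] at hab
  have hsymm : b ⬝ᵥ S *ᵥ a = a ⬝ᵥ S *ᵥ b := by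
    have : Sᵀ = S := hS.isHermitian
    rw [dotProduct_comm, ← vecMul_transpose, this, dotProduct_mulVec]
  rw [hab, h.variance_eq hW hS, h.variance_eq hW hS, mulVec_add, add_dotProduct,
    dotProduct_add, dotProduct_add, hsymm] at hadd
  linarith

end IsCenteredGaussianVec

open Matrix in
lemma Matrix.dotProduct_mulVec_snoc {p : ℕ} {S : Matrix (Fin (p + 1)) (Fin (p + 1)) ℝ}
    (hS : S.IsHermitian) (a d : Fin p → ℝ) (s t : ℝ) :
    (Fin.snoc a s : Fin (p + 1) → ℝ) ⬝ᵥ S *ᵥ (Fin.snoc d t : Fin (p + 1) → ℝ) =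
      a ⬝ᵥ S.submatrix Fin.castSucc Fin.castSucc *ᵥ d +
        s * (d ⬝ᵥ fun i ↦ S i.castSucc (Fin.last p)) +
        t * (a ⬝ᵥ fun i ↦ S i.castSucc (Fin.last p)) +
        s * t * S (Fin.last p) (Fin.last p) := by
  have hsymm (i : Fin p) : S (Fin.last p) i.castSucc = S i.castSucc (Fin.last p) := by
    simpa using hS.apply i.castSucc (Fin.last p)
  simp only [dotProduct, mulVec, Fin.sum_univ_castSucc, Fin.snoc_castSucc, Fin.snoc_last,
    submatrix_apply, hsymm, mul_add, Finset.sum_add_distrib, Finset.mul_sum]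
  simp only [add_assoc]
  congr 1
  congr 1
  · exact Finset.sum_congr rfl fun i _ ↦ by ring
  congr 1
  · exact Finset.sum_congr rfl fun i _ ↦ by ring
  · ring

/-- In a positive semidefinite block matrix, the off-diagonal column lies in the range of the
upper-left block, so that any generalized inverse of the latter solves the normal equations. -/
lemma Matrix.PosSemidef.mulVec_mulVec_generalizedInverse {p : ℕ}
    {S : Matrix (Fin (p + 1)) (Fin (p + 1)) ℝ} (hS : S.PosSemidef) {G : Matrix (Fin p) (Fin p) ℝ}
    (hG : S.submatrix Fin.castSucc Fin.castSucc * G * S.submatrix Fin.castSucc Fin.castSucc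
        = S.submatrix Fin.castSucc Fin.castSucc) :
    (S.submatrix Fin.castSucc Fin.castSucc).mulVec
      (G.mulVec fun i ↦ S i.castSucc (Fin.last p)) = fun i ↦ S i.castSucc (Fin.last p) := by
  set A := S.submatrix Fin.castSucc Fin.castSucc with hA
  set b : Fin p → ℝ := fun i ↦ S i.castSucc (Fin.last p) with hb
  have hAsymm : A.transpose = A := hS.isHermitian.submatrix Fin.castSucc
  have hker (k : Fin p → ℝ) (hk : A.mulVec k = 0) : dotProduct k b = 0 := by
    have hquad := dotProduct_mulVec_snoc hS.isHermitian k k 0 0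
    rw [← hA, hk] at hquad
    have hzero := (hS.dotProduct_mulVec_zero_iff (Fin.snoc k 0)).1 (by
      rw [star_trivial, hquad]; simp)
    have hlast := dotProduct_mulVec_snoc hS.isHermitian 0 k 1 0
    rw [hzero] at hlast
    simpa using hlast.symm
  have hGT : A * G.transpose * A = A := by
    simpa [Matrix.transpose_mul, hAsymm, Matrix.mul_assoc] using congrArg Matrix.transpose hG
  refine dotProduct_eq _ _ fun u ↦ ?_
  have hu := hker (u - (G.transpose * A).mulVec u) (by
    rw [Matrix.mulVec_sub, Matrix.mulVec_mulVec, ← Matrix.mul_assoc, hGT, sub_self])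
  rw [sub_dotProduct, sub_eq_zero] at hu
  rw [dotProduct_comm b, hu, dotProduct_comm _ u, Matrix.mulVec_mulVec, dotProduct_mulVec,
    ← Matrix.mulVec_transpose, Matrix.transpose_mul, hAsymm]

/-- The residual of the best linear prediction is independent of the predictors. -/
lemma IsCenteredGaussianVec.indepFun_sub_linear {Ω : Type*} [MeasurableSpace Ω] {P : Measure Ω}
    [IsProbabilityMeasure P] {p : ℕ} {X : Ω → Fin p → ℝ} {Y : Ω → ℝ} (hX : Measurable X)
    (hY : Measurable Y) {S : Matrix (Fin (p + 1)) (Fin (p + 1)) ℝ} (hS : S.PosSemidef)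
    (h : IsCenteredGaussianVec P (fun ω ↦ Fin.snoc (X ω) (Y ω)) S) {w : Fin p → ℝ}
    (hw : (S.submatrix Fin.castSucc Fin.castSucc).mulVec w =
      fun i ↦ S i.castSucc (Fin.last p)) :
    IndepFun X (fun ω ↦ Y ω - ∑ i, w i * X ω i) P := by
  have hW := hX.finSnoc hY
  let proj (i : Fin (p + 1)) := ContinuousLinearMap.proj (R := ℝ) (φ := fun _ : Fin (p + 1) ↦ ℝ) i
  let Φ := (ContinuousLinearMap.pi fun i : Fin p ↦ proj i.castSucc).prod
    (proj (Fin.last p) - ∑ i, w i • proj i.castSucc)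
  have hjoint : HasGaussianLaw (fun ω ↦ (X ω, Y ω - ∑ i, w i * X ω i)) P := by
    have := (h.hasGaussianLaw hW).map_fun Φ
    have hΦ : (fun ω ↦ (X ω, Y ω - ∑ i, w i * X ω i)) =
        fun ω ↦ Φ (Fin.snoc (X ω) (Y ω) : Fin (p + 1) → ℝ) := by
      ext ω <;> simp [Φ, proj, _root_.sum_apply]
    rwa [hΦ]
  refine hjoint.indepFun_of_covariance_strongDual fun L M ↦ ?_
  have hL : L ∘ X = fun ω ↦ ∑ i, (Fin.snoc (fun i ↦ L (Pi.single i 1)) 0 : Fin (p + 1) → ℝ) i *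
      (Fin.snoc (X ω) (Y ω) : Fin (p + 1) → ℝ) i := by
    ext ω
    simp only [Fin.sum_univ_castSucc, Fin.snoc_castSucc, Fin.snoc_last, zero_mul, add_zero]
    exact L.apply_eq_sum_single (X ω)
  have hM : (M ∘ fun ω ↦ Y ω - ∑ i, w i * X ω i) = fun ω ↦
      ∑ i, (Fin.snoc (-(M 1 • w)) (M 1) : Fin (p + 1) → ℝ) i *
        (Fin.snoc (X ω) (Y ω) : Fin (p + 1) → ℝ) i := by
    ext ω
    have hmul (t : ℝ) : M t = t * M 1 := by simpa using map_smul M t 1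
    simp only [Fin.sum_univ_castSucc, Fin.snoc_castSucc, Fin.snoc_last, Function.comp_apply,
      Pi.neg_apply, Pi.smul_apply, smul_eq_mul, neg_mul, Finset.sum_neg_distrib, mul_assoc,
      ← Finset.mul_sum]
    rw [hmul]
    ring
  rw [hL, hM, h.covariance_eq hW hS, Matrix.dotProduct_mulVec_snoc hS.isHermitian,
    Matrix.mulVec_neg, Matrix.mulVec_smul, hw]
  simp

/-- The rank correlation of `Y = g(X) + U` where `g(X)` and `U` are centered Gaussians, `U` is
independent of `X` and `Y` is standard Gaussian. -/
lemma xi_eq_of_indepFun_gaussian {Ω α : Type*} [MeasurableSpace Ω] [MeasurableSpace α]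
    (P : Measure Ω) [IsProbabilityMeasure P] {X : Ω → α} (hX : Measurable X) {Y : Ω → ℝ}
    (hY : Measurable Y) (hYlaw : P.map Y = gaussianReal 0 1) {g : α → ℝ} (hg : Measurable g)
    {s v : NNReal} (hsv : s + v = 1) (hglaw : P.map (fun ω ↦ g (X ω)) = gaussianReal 0 s)
    (hUlaw : P.map (fun ω ↦ Y ω - g (X ω)) = gaussianReal 0 v)
    (hXU : IndepFun X (fun ω ↦ Y ω - g (X ω)) P) :
    xi P Y X = 3 / Real.pi * Real.arcsin ((1 + s) / 2) - 1 / 2 := by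
  have hnum (y : ℝ) : variance (P[Set.indicator {ω | y ≤ Y ω} (fun _ ↦ (1 : ℝ)) |
      MeasurableSpace.comap X inferInstance]) P =
      variance (fun ω ↦ gaussianSurvival v (y - g (X ω))) P := by
    refine variance_congr ?_
    simpa using condExp_indicator_le_ae_eq P hX (by fun_prop) hXU hUlaw hg y
  have hden (y : ℝ) : Set.indicator {ω | y ≤ Y ω} (fun _ ↦ (1 : ℝ)) =
      fun ω ↦ gaussianSurvival 0 (y - Y ω) := by
    ext ω
    simp [gaussianSurvival, Measure.real, Set.indicator_apply, apply_ite]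
  rw [xi, xiSigma, hYlaw]
  simp_rw [hnum, hden]
  rw [integral_variance_gaussianSurvival P hsv (by fun_prop) hglaw,
    integral_variance_gaussianSurvival P (add_zero 1) hY hYlaw]
  have := Real.pi_pos
  norm_num [Real.arcsin_one]
  field_simp
  ring

theorem xi_gaussian_closed_form
    {Ω : Type*} [MeasurableSpace Ω] (P : Measure Ω) [IsProbabilityMeasure P]
    {p : ℕ} (X : Ω → (Fin p → ℝ)) (Y : Ω → ℝ)
    (hX : Measurable X) (hY : Measurable Y)
    (S : Matrix (Fin (p + 1)) (Fin (p + 1)) ℝ) (hS : S.PosSemidef)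
    (hGauss : IsCenteredGaussianVec P (fun ω => Fin.snoc (X ω) (Y ω)) S)
    (hYvar : S (Fin.last p) (Fin.last p) = 1)
    (G : Matrix (Fin p) (Fin p) ℝ)
    (hG : S.submatrix Fin.castSucc Fin.castSucc * G * S.submatrix Fin.castSucc Fin.castSucc
        = S.submatrix Fin.castSucc Fin.castSucc) :
    xi P Y X =
      3 / Real.pi *
        Real.arcsin
          ((1 + Real.sqrt (∑ i, ∑ j,
              S (Fin.last p) (Fin.castSucc i) * G i j * S (Fin.castSucc j) (Fin.last p)) ^ 2)
            / 2) - 1 / 2 := by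
  set A := S.submatrix Fin.castSucc Fin.castSucc with hA
  set b : Fin p → ℝ := fun i ↦ S i.castSucc (Fin.last p) with hb
  set w := G.mulVec b with hw
  have hAw : A.mulVec w = b := hS.mulVec_mulVec_generalizedInverse hG
  have hρ : ∑ i, ∑ j, S (Fin.last p) i.castSucc * G i j * S j.castSucc (Fin.last p) =
      dotProduct w b := by
    rw [dotProduct_comm]
    simp only [hw, hb, dotProduct, Matrix.mulVec, Finset.mul_sum, mul_assoc]
    refine Finset.sum_congr rfl fun i _ ↦ Finset.sum_congr rfl fun j _ ↦ ?_
    rw [← hS.isHermitian.apply (Fin.last p) i.castSucc, star_trivial]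
  rw [hρ]
  have hquad (c d : ℝ) : dotProduct (Fin.snoc (c • w) d : Fin (p + 1) → ℝ)
      (S.mulVec (Fin.snoc (c • w) d : Fin (p + 1) → ℝ)) =
      (c ^ 2 + 2 * c * d) * dotProduct w b + d ^ 2 := by
    rw [Matrix.dotProduct_mulVec_snoc hS.isHermitian, ← hA, ← hb, Matrix.mulVec_smul, hAw, hYvar]
    simp only [smul_dotProduct, dotProduct_smul, smul_eq_mul]
    ring
  have hpsd (c d : ℝ) : 0 ≤ (c ^ 2 + 2 * c * d) * dotProduct w b + d ^ 2 := by
    rw [← hquad]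
    simpa using hS.dotProduct_mulVec_nonneg (Fin.snoc (c • w) d : Fin (p + 1) → ℝ)
  have hlaw (c d : ℝ) : P.map (fun ω ↦ c * ∑ i, w i * X ω i + d * Y ω) =
      gaussianReal 0 ((c ^ 2 + 2 * c * d) * dotProduct w b + d ^ 2).toNNReal := by
    rw [← hquad, ← hGauss]
    simp [Fin.sum_univ_castSucc, Finset.mul_sum, mul_assoc]
  have hρ0 : 0 ≤ dotProduct w b := by simpa using hpsd 1 0
  have hρ1 : 0 ≤ 1 - dotProduct w b := by linarith [hpsd (-1) 1]
  have hsv : (dotProduct w b).toNNReal + (1 - dotProduct w b).toNNReal = 1 := by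
    rw [← Real.toNNReal_add hρ0 hρ1]
    simp
  rw [Real.sq_sqrt hρ0, ← Real.coe_toNNReal _ hρ0]
  refine xi_eq_of_indepFun_gaussian P hX hY ?_ (g := fun x ↦ ∑ i, w i * x i) (by fun_prop) hsv
    ?_ ?_ (hGauss.indepFun_sub_linear hX hY hS hAw)
  · simpa using hlaw 0 1
  · simpa using hlaw 1 0
  · convert hlaw (-1) 1 using 2
    · ext ω
      ring
    · congr 1
      ring
end
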